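/- arXiv:2412.10879 — 8 statements merged into one kernel-verified Lean document; each statement's English description precedes it below -/
import Mathlib

section
/- Let A and B be abelian groups with filtrations F_A, F_B, where F_A is Hausdorff, and let f : A → B be a filtration-preserving homomorphism. Let s, n, p be natural numbers with p ≤ s + n, let x ∈ F_A s, and let y ∈ F_B (s+n) with y ∉ F_B (s+n+1). Assume there is an f-extension of length n from x (at filtration s) to y. Then the following are equivalent: (i) there is no crossing of this f-extension hitting the range [p, s+n]; (ii) every a ∈ A with a − x ∈ F_A (s+1) and f a ∈ F_B p satisfies f a − y ∈ F_B (s+n+1). (In the paper's language: an f-extension d_n^f(x) = y has no crossing hitting the range AF ≥ p if and only if, for every homotopy class [x] detected by x with AF(f[x]) ≥ p, the class f[x] is detected by y.) -/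
/-- An element lying in stage `k` but not in stage `l + 1` of a filtration has an exact filtration
between `k` and `l`. -/
theorem exists_exact_filtration {B : Type*} [AddCommGroup B] (F : ℕ → AddSubgroup B)
    {k l : ℕ} {b : B} (hk : b ∈ F k) (hl : b ∉ F (l + 1)) (hkl : k ≤ l) :
    ∃ q, k ≤ q ∧ q ≤ l ∧ b ∈ F q ∧ b ∉ F (q + 1) := by
  by_contra! h
  have key : ∀ q, k ≤ q → q ≤ l + 1 → b ∈ F q := by
    intro q hq
    induction q, hq using Nat.le_induction with
    | base => exact fun _ => hk
    | succ q hq ih => exact fun hle => h q hq (by omega) (ih (by omega))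
  exact hl (key (l + 1) (by omega) le_rfl)


/-- An f-extension `d_n^f(x) = y` has no crossing hitting the range
`[p, s+n]` if and only if every class `[x]` detected by `x` with `AF(f[x]) ≥ p`
has `f[x]` detected by `y`. -/
theorem ess_no_crossing_iff_range
    {A B : Type*} [AddCommGroup A] [AddCommGroup B]
    (FA : ℕ → AddSubgroup A) (FB : ℕ → AddSubgroup B)
    (hFA : ∀ t, FA (t + 1) ≤ FA t) (hFB : ∀ t, FB (t + 1) ≤ FB t)
    (hHaus : ∀ a : A, (∀ t, a ∈ FA t) → a = 0)
    (f : A →+ B) (hf : ∀ t, ∀ a ∈ FA t, f a ∈ FB t)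
    (s n p : ℕ) (hp : p ≤ s + n)
    (x : A) (hx : x ∈ FA s)
    (y : B) (hy : y ∈ FB (s + n)) (hy' : y ∉ FB (s + n + 1))
    (hext : ∃ a : A, a - x ∈ FA (s + 1) ∧ f a - y ∈ FB (s + n + 1)) :
    (¬ ∃ (a' m : ℕ), 1 ≤ a' ∧ p ≤ s + a' + m ∧ s + a' + m ≤ s + n ∧
        ∃ x' ∈ FA (s + a'), ∃ y' ∈ FB (s + a' + m), y' ∉ FB (s + a' + m + 1) ∧
          ∃ c : A, c - x' ∈ FA (s + a' + 1) ∧ f c - y' ∈ FB (s + a' + m + 1))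
      ↔
    (∀ a : A, a - x ∈ FA (s + 1) → f a ∈ FB p → f a - y ∈ FB (s + n + 1)) := by
  have hA : Antitone FA := antitone_nat_of_succ_le hFA
  have hB : Antitone FB := antitone_nat_of_succ_le hFB
  obtain ⟨a₀, ha₀, hfa₀⟩ := hext
  constructor
  · intro hno a ha hfa
    by_contra hne
    have hd : a - a₀ ∈ FA (s + 1) := by simpa using sub_mem ha ha₀
    have hfd : f (a - a₀) ∉ FB (s + n + 1) := fun h =>
      hne (by simpa using add_mem h hfa₀)
    have hfa₀' : f a₀ ∈ FB (s + n) := by simpa using add_mem (hFB _ hfa₀) hy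
    have hfdp : f (a - a₀) ∈ FB p := by
      rw [map_sub]
      exact sub_mem hfa (hB hp hfa₀')
    have hfds : f (a - a₀) ∈ FB (s + 1) := hf _ _ hd
    have hn : s + 1 ≤ s + n := by
      by_contra hlt
      exact hfd (hB (by omega) hfds)
    have hmax : f (a - a₀) ∈ FB (max p (s + 1)) := by
      rcases max_choice p (s + 1) with h | h <;> rw [h] <;> assumption
    obtain ⟨q, hq, hqn, hmem, hnot⟩ := exists_exact_filtration FB hmax hfd (max_le hp hn)
    obtain ⟨hpq, hsq⟩ := max_le_iff.mp hq
    obtain ⟨m, rfl⟩ := Nat.exists_eq_add_of_le hsq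
    exact hno ⟨1, m, le_rfl, hpq, hqn, a - a₀, hd, f (a - a₀), hmem, hnot, a - a₀,
      by simp, by simp⟩
  · rintro hall ⟨a', m, ha', hpm, hmn, x', hx', y', hy'mem, hy'not, c, hc, hfc⟩
    have hcA : c ∈ FA (s + a') := by simpa using add_mem (hFA _ hc) hx'
    have hfcB : f c ∈ FB (s + a' + m) := by simpa using add_mem (hFB _ hfc) hy'mem
    have hfa₀' : f a₀ ∈ FB (s + n) := by simpa using add_mem (hFB _ hfa₀) hy
    have hdetect : f (a₀ + c) - y ∈ FB (s + n + 1) := by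
      refine hall (a₀ + c) ?_ ?_
      · rw [add_sub_right_comm]
        exact add_mem ha₀ (hA (by omega) hcA)
      · rw [map_add]
        exact add_mem (hB hp hfa₀') (hB hpm hfcB)
    have hfc' : f c ∈ FB (s + n + 1) := by simpa using sub_mem hdetect hfa₀
    exact hy'not (by simpa using sub_mem (hB (by omega) hfc') hfc)
end

section
/- Let A and B be abelian groups with filtrations F_A, F_B, where F_A is Hausdorff, and let f : A → B be a filtration-preserving homomorphism. Let s, n be natural numbers, let x ∈ F_A s, and assume there is an f-extension of length n from x (at filtration s) to 0, i.e. there exists a₀ ∈ A with a₀ − x ∈ F_A (s+1) and f a₀ ∈ F_B (s+n+1). Then the following are equivalent: (i) there is no crossing of this f-extension hitting the range [s+1, s+n]; (ii) every a ∈ A with a − x ∈ F_A (s+1) satisfies f a ∈ F_B (s+n+1). (In the paper's language: the f-extension d_n^f(x) = 0 has no crossing if and only if AF(f[x]) > AF(x) + n for every class [x] detected by x.) -/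
/-- An f-extension `d_n^f(x) = 0` has no crossing if and only if
`AF(f[x]) > AF(x) + n` for every class `[x]` detected by `x`. -/
theorem ess_no_crossing_iff_zero_target
    {A B : Type*} [AddCommGroup A] [AddCommGroup B]
    (FA : ℕ → AddSubgroup A) (FB : ℕ → AddSubgroup B)
    (hFA : ∀ t, FA (t + 1) ≤ FA t) (hFB : ∀ t, FB (t + 1) ≤ FB t)
    (hHaus : ∀ a : A, (∀ t, a ∈ FA t) → a = 0)
    (f : A →+ B) (hf : ∀ t, ∀ a ∈ FA t, f a ∈ FB t)
    (s n : ℕ)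
    (x : A) (hx : x ∈ FA s)
    (hext : ∃ a : A, a - x ∈ FA (s + 1) ∧ f a ∈ FB (s + n + 1)) :
    (¬ ∃ (a' m : ℕ), 1 ≤ a' ∧ s + 1 ≤ s + a' + m ∧ s + a' + m ≤ s + n ∧
        ∃ x' ∈ FA (s + a'), ∃ y' ∈ FB (s + a' + m), y' ∉ FB (s + a' + m + 1) ∧
          ∃ c : A, c - x' ∈ FA (s + a' + 1) ∧ f c - y' ∈ FB (s + a' + m + 1))
      ↔
    (∀ a : A, a - x ∈ FA (s + 1) → f a ∈ FB (s + n + 1)) := by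
  obtain ⟨a₀, ha₀, hfa₀⟩ := hext
  constructor
  · intro hcross a ha
    have hz : a - a₀ ∈ FA (s + 1) := by
      simpa using (FA (s + 1)).sub_mem ha ha₀
    have key : ∀ k ≤ n, f (a - a₀) ∈ FB (s + 1 + k) := by
      intro k
      induction k with
      | zero => exact fun _ => hf _ _ hz
      | succ k ih =>
        intro hk
        by_contra hnot
        exact hcross ⟨1, k, le_rfl, by omega, by omega, a - a₀, hz, f (a - a₀),
          ih (by omega), hnot, a - a₀, by simp, by simp⟩
    have hfz := key n le_rfl
    rw [Nat.add_right_comm] at hfz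
    simpa using (FB (s + n + 1)).add_mem hfz hfa₀
  · rintro hall ⟨k, m, hk, -, hle, x', hx', y', -, hy', c, hc, hfc⟩
    have hFA_anti : Antitone FA := antitone_nat_of_succ_le hFA
    have hFB_anti : Antitone FB := antitone_nat_of_succ_le hFB
    have hcmem : c ∈ FA (s + 1) := by
      have h := (FA (s + k)).add_mem (hFA _ hc) hx'
      rw [sub_add_cancel] at h
      exact hFA_anti (by omega) h
    have hsum : f (a₀ + c) ∈ FB (s + n + 1) := by
      apply hall
      rw [add_sub_right_comm]
      exact (FA (s + 1)).add_mem ha₀ hcmem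
    have hfcmem : f c ∈ FB (s + n + 1) := by
      simpa using (FB (s + n + 1)).sub_mem hsum hfa₀
    apply hy'
    simpa using (FB (s + k + m + 1)).sub_mem (hFB_anti (by omega) hfcmem) hfc
end

section
/- Let A and B be abelian groups with filtrations F_A, F_B, and let f : A → B be a homomorphism satisfying f(F_A t) ⊆ F_B (t+n) for every t (i.e. f has Adams filtration at least n). Then for every natural number s there is no crossing of an f-extension of length n at filtration s: there do not exist natural numbers a ≥ 1, m ≥ 0 with s+1 ≤ s+a+m ≤ s+n, elements x' ∈ F_A (s+a) and y' ∈ F_B (s+a+m) with y' ∉ F_B (s+a+m+1), and an f-extension of length m from x' (at filtration s+a) to y'. (In the paper's language: if AF(f) = n, then all d_n^f-differentials have no crossing in the f-extension spectral sequence.) -/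
/-- If `AF(f) = n` (i.e. `f (F_A t) ⊆ F_B (t+n)` for all `t`),
then all `d_n^f`-differentials have no crossing in the f-extension spectral
sequence. -/
theorem ess_af_n_no_crossing
    {A B : Type*} [AddCommGroup A] [AddCommGroup B]
    (FA : ℕ → AddSubgroup A) (FB : ℕ → AddSubgroup B)
    (hFA : ∀ t, FA (t + 1) ≤ FA t) (hFB : ∀ t, FB (t + 1) ≤ FB t)
    (f : A →+ B) (n : ℕ) (hf : ∀ t, ∀ a ∈ FA t, f a ∈ FB (t + n)) :
    ∀ s : ℕ, ¬ ∃ (a' m : ℕ), 1 ≤ a' ∧ s + 1 ≤ s + a' + m ∧ s + a' + m ≤ s + n ∧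
        ∃ x' ∈ FA (s + a'), ∃ y' ∈ FB (s + a' + m), y' ∉ FB (s + a' + m + 1) ∧
          ∃ c : A, c - x' ∈ FA (s + a' + 1) ∧ f c - y' ∈ FB (s + a' + m + 1) := by
  rintro s ⟨a, m, ha, -, hm, x, hx, y, -, hy, c, hcx, hfc⟩
  have hc : c ∈ FA (s + a) := by
    simpa using (FA (s + a)).add_mem (hFA _ hcx) hx
  have hfc' : f c ∈ FB (s + a + m + 1) :=
    antitone_nat_of_succ_le hFB (by omega) (hf _ c hc)
  exact hy (by simpa using (FB (s + a + m + 1)).sub_mem hfc' hfc)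
end

section
/- Let A, B, C, D be abelian groups with filtrations F_A, F_B, F_C, F_D, and let f : A → B, p : A → C, g : C → D, q : B → D be filtration-preserving homomorphisms with q ∘ f = g ∘ p. Let s, n, m, l, k be natural numbers with 0 < k and k ≤ m + l − n (so in particular n ≤ m + l), and let x ∈ F_A s, y ∈ F_B (s+n), z ∈ F_C (s+m), w ∈ F_D (s+m+l). Assume: (1) there is an f-extension of length n from x (at filtration s) to y; (2) there is a p-extension of length m from x (at filtration s) to z; (3) either every a ∈ A with a − x ∈ F_A (s+1) satisfies f a − y ∈ F_B (s+n+1), or every a ∈ A with a − x ∈ F_A (s+1) satisfies p a − z ∈ F_C (s+m+1) [i.e. the extension in (1) or the extension in (2) has no crossing]; (4) every c ∈ C with c − z ∈ F_C (s+m+1) and g c ∈ F_D (s+n+k) satisfies g c − w ∈ F_D (s+m+l+1) [i.e. the g-extension d_l^g(z) = w has no crossing hitting the range AF ≥ s+n+k]; (5) every b ∈ B with b − y ∈ F_B (s+n+1) satisfies q b ∈ F_D (s+n+k) [i.e. d_{k−1}^q(y) = 0 with no crossing]. Then there is a q-extension of length m+l−n from y (at filtration s+n) to w, i.e. there exists b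 ∈ B with b − y ∈ F_B (s+n+1) and q b − w ∈ F_D (s+m+l+1). -/
/-- Theorem 2.13 of the paper (Theorem `4114f70c`), at the level of
filtered abelian groups: a commuting square of filtration-preserving maps
propagates extensions, yielding a q-extension of length `m+l-n` from `y` to `w`. -/
theorem ess_square_propagation
    {A B C D : Type*} [AddCommGroup A] [AddCommGroup B] [AddCommGroup C] [AddCommGroup D]
    (FA : ℕ → AddSubgroup A) (FB : ℕ → AddSubgroup B)
    (FC : ℕ → AddSubgroup C) (FD : ℕ → AddSubgroup D)
    (hFA : ∀ t, FA (t + 1) ≤ FA t) (hFB : ∀ t, FB (t + 1) ≤ FB t)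
    (hFC : ∀ t, FC (t + 1) ≤ FC t) (hFD : ∀ t, FD (t + 1) ≤ FD t)
    (f : A →+ B) (p : A →+ C) (g : C →+ D) (q : B →+ D)
    (hf : ∀ t, ∀ a ∈ FA t, f a ∈ FB t) (hp : ∀ t, ∀ a ∈ FA t, p a ∈ FC t)
    (hg : ∀ t, ∀ c ∈ FC t, g c ∈ FD t) (hq : ∀ t, ∀ b ∈ FB t, q b ∈ FD t)
    (hcomm : ∀ a : A, q (f a) = g (p a))
    (s n m l k : ℕ) (hk : 0 < k) (hkml : n + k ≤ m + l)
    (x : A) (hx : x ∈ FA s)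
    (y : B) (hy : y ∈ FB (s + n))
    (z : C) (hz : z ∈ FC (s + m))
    (w : D) (hw : w ∈ FD (s + m + l))
    (h1 : ∃ a : A, a - x ∈ FA (s + 1) ∧ f a - y ∈ FB (s + n + 1))
    (h2 : ∃ a : A, a - x ∈ FA (s + 1) ∧ p a - z ∈ FC (s + m + 1))
    (h3 : (∀ a : A, a - x ∈ FA (s + 1) → f a - y ∈ FB (s + n + 1)) ∨
          (∀ a : A, a - x ∈ FA (s + 1) → p a - z ∈ FC (s + m + 1)))
    (h4 : ∀ c : C, c - z ∈ FC (s + m + 1) → g c ∈ FD (s + n + k) →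
          g c - w ∈ FD (s + m + l + 1))
    (h5 : ∀ b : B, b - y ∈ FB (s + n + 1) → q b ∈ FD (s + n + k)) :
    ∃ b : B, b - y ∈ FB (s + n + 1) ∧ q b - w ∈ FD (s + m + l + 1) := by
  obtain ⟨a, hfa, hpa⟩ : ∃ a : A, f a - y ∈ FB (s + n + 1) ∧ p a - z ∈ FC (s + m + 1) := by
    rcases h3 with h | h
    · obtain ⟨a, ha, hpa⟩ := h2
      exact ⟨a, h a ha, hpa⟩
    · obtain ⟨a, ha, hfa⟩ := h1
      exact ⟨a, hfa, h a ha⟩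
  refine ⟨f a, hfa, ?_⟩
  have hq_fa := h5 (f a) hfa
  rw [hcomm] at hq_fa ⊢
  exact h4 (p a) hpa hq_fa
end

section
/- Let A, B, C, D be abelian groups with filtrations F_A, F_B, F_C, F_D, let f : A → B, p : A → C, g : C → D, q : B → D be filtration-preserving homomorphisms with q ∘ f = g ∘ p, and let r be a natural number such that p (F_A t) ⊆ F_C (t+r) and q (F_B t) ⊆ F_D (t+r) for every t [i.e. the p- and q-extension spectral sequences satisfy ESS_0 = ESS_r]. Let s, n be natural numbers, x ∈ F_A s, y ∈ F_B (s+n), and suppose a ∈ A is an f-extension of length n from x (at filtration s) to y, i.e. a − x ∈ F_A (s+1) and f a − y ∈ F_B (s+n+1). Then: (i) for any other f-extension a' of length n from x to y, one has p a − p a' ∈ F_C (s+r+1) (so the class of p a modulo F_C (s+r+1) depends only on x and y); and (ii) p a ∈ F_C (s+r), and for every b ∈ B with b − y ∈ F_B (s+n+1), one has q b ∈ F_D (s+n+r) and p a is a g-extension of length n from p a (at filtration s+r) to q b, that is, g (p a) − q b ∈ F_D (s+n+r+1). (This says that the pair (d_r^p, d_r^q) induces a map from the f-extension spectral sequence to the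 g-extension spectral sequence.) -/
/-- Corollary `e7b20ae2` of the paper: if `p` and `q` raise
filtration by exactly `r` (ESS₀ = ESS_r for the p- and q-extension spectral
sequences), then `(d_r^p, d_r^q)` induces a map from the f-extension spectral
sequence to the g-extension spectral sequence. -/
theorem ess_induced_map
    {A B C D : Type*} [AddCommGroup A] [AddCommGroup B] [AddCommGroup C] [AddCommGroup D]
    (FA : ℕ → AddSubgroup A) (FB : ℕ → AddSubgroup B)
    (FC : ℕ → AddSubgroup C) (FD : ℕ → AddSubgroup D)
    (hFA : ∀ t, FA (t + 1) ≤ FA t) (hFB : ∀ t, FB (t + 1) ≤ FB t)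
    (hFC : ∀ t, FC (t + 1) ≤ FC t) (hFD : ∀ t, FD (t + 1) ≤ FD t)
    (f : A →+ B) (p : A →+ C) (g : C →+ D) (q : B →+ D)
    (hf : ∀ t, ∀ a ∈ FA t, f a ∈ FB t) (hg : ∀ t, ∀ c ∈ FC t, g c ∈ FD t)
    (hcomm : ∀ a : A, q (f a) = g (p a))
    (r : ℕ)
    (hp : ∀ t, ∀ a ∈ FA t, p a ∈ FC (t + r))
    (hq : ∀ t, ∀ b ∈ FB t, q b ∈ FD (t + r))
    (s n : ℕ)
    (x : A) (hx : x ∈ FA s)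
    (y : B) (hy : y ∈ FB (s + n))
    (a : A) (ha1 : a - x ∈ FA (s + 1)) (ha2 : f a - y ∈ FB (s + n + 1)) :
    (∀ a' : A, a' - x ∈ FA (s + 1) → f a' - y ∈ FB (s + n + 1) →
        p a - p a' ∈ FC (s + r + 1)) ∧
    p a ∈ FC (s + r) ∧
    (∀ b : B, b - y ∈ FB (s + n + 1) →
        q b ∈ FD (s + n + r) ∧ g (p a) - q b ∈ FD (s + n + r + 1)) := by
  refine ⟨fun a' ha' _ => ?_, ?_, fun b hb => ⟨?_, ?_⟩⟩
  · have h : a - a' ∈ FA (s + 1) := by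
      simpa using sub_mem ha1 ha'
    simpa [map_sub, Nat.add_right_comm] using hp _ _ h
  · have h : a ∈ FA s := by
      simpa using add_mem (hFA s ha1) hx
    exact hp s a h
  · have h : b ∈ FB (s + n) := by
      simpa using add_mem (hFB _ hb) hy
    exact hq _ _ h
  · have h : f a - b ∈ FB (s + n + 1) := by
      simpa using sub_mem ha2 hb
    rw [← hcomm, ← map_sub, Nat.add_right_comm]
    exact hq _ _ h
end

section
/- Let A, B, C be abelian groups with filtrations F_A, F_B, F_C, where F_A is exhaustive and Hausdorff, and let f : A → B and g : B → C be filtration-preserving homomorphisms such that the sequence A → B → C is exact at B (the range of f equals the kernel of g). Let t be a natural number and y ∈ F_B t with y ∉ F_B (t+1), and suppose y is a permanent cycle in the g-extension spectral sequence, i.e. there exists b ∈ B with b − y ∈ F_B (t+1) and g b = 0. Then y is a boundary in the f-extension spectral sequence: there exist a natural number s ≤ t and x ∈ F_A s with x ∉ F_A (s+1) such that f x − y ∈ F_B (t+1); in particular there is an f-extension of length t − s from x (at filtration s) to y. -/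
/-- Proposition `cfe810af` of the paper: if `A → B → C` is exact at
`B` and `F_A` is exhaustive and Hausdorff, then every permanent cycle of the
g-extension spectral sequence is a boundary in the f-extension spectral
sequence. -/
theorem ess_permanent_cycles_are_boundaries
    {A B C : Type*} [AddCommGroup A] [AddCommGroup B] [AddCommGroup C]
    (FA : ℕ → AddSubgroup A) (FB : ℕ → AddSubgroup B) (FC : ℕ → AddSubgroup C)
    (hFA : ∀ t, FA (t + 1) ≤ FA t) (hFB : ∀ t, FB (t + 1) ≤ FB t)
    (hFC : ∀ t, FC (t + 1) ≤ FC t)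
    (hExh : FA 0 = ⊤)
    (hHaus : ∀ a : A, (∀ t, a ∈ FA t) → a = 0)
    (f : A →+ B) (g : B →+ C)
    (hf : ∀ t, ∀ a ∈ FA t, f a ∈ FB t) (hg : ∀ t, ∀ b ∈ FB t, g b ∈ FC t)
    (hexact : ∀ b : B, g b = 0 ↔ ∃ a : A, f a = b)
    (t : ℕ)
    (y : B) (hy : y ∈ FB t) (hy' : y ∉ FB (t + 1))
    (hperm : ∃ b : B, b - y ∈ FB (t + 1) ∧ g b = 0) :
    ∃ s : ℕ, s ≤ t ∧ ∃ x : A, x ∈ FA s ∧ x ∉ FA (s + 1) ∧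
      f x - y ∈ FB (t + 1) := by
  classical
  obtain ⟨b, hby, hgb⟩ := hperm
  obtain ⟨a, rfl⟩ := (hexact b).mp hgb
  have ha : a ∉ FA (t + 1) := fun h =>
    hy' (by simpa using (FB (t + 1)).sub_mem (hf _ a h) hby)
  have hex : ∃ n, a ∉ FA n := ⟨t + 1, ha⟩
  obtain ⟨s, hs⟩ : ∃ s, Nat.find hex = s + 1 := by
    refine Nat.exists_eq_succ_of_ne_zero fun h => ?_
    have h0 := Nat.find_spec hex
    rw [h, hExh] at h0
    exact h0 (AddSubgroup.mem_top a)
  refine ⟨s, ?_, a, ?_, hs ▸ Nat.find_spec hex, hby⟩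
  · have := Nat.find_min' hex ha
    omega
  · exact not_not.mp (Nat.find_min hex (by omega))
end

section
/- Let A and B be abelian groups with filtrations F_A, F_B, and let f : A → B be a filtration-preserving homomorphism. Let s, n be natural numbers, x ∈ F_A s, and y, y' ∈ F_B (s+n). If there is an f-extension of length n from x (at filtration s) to y and also an f-extension of length n from x (at filtration s) to y', then there exists c ∈ F_A (s+1) with f c − (y − y') ∈ F_B (s+n+1). (In the paper's language: if d_n^f(x) = y and d_n^f(x) = y', then there exists a class [x'] with Adams filtration strictly greater than that of x such that f[x'] is detected by y − y'.) -/
/-- Proposition 2.8(3)(a) of the paper: if `d_n^f(x) = y` and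
`d_n^f(x) = y'`, then there is a class of strictly higher filtration whose
image under `f` is detected by `y - y'`. -/
theorem ess_two_targets_same_length
    {A B : Type*} [AddCommGroup A] [AddCommGroup B]
    (FA : ℕ → AddSubgroup A) (FB : ℕ → AddSubgroup B)
    (hFA : ∀ t, FA (t + 1) ≤ FA t) (hFB : ∀ t, FB (t + 1) ≤ FB t)
    (f : A →+ B) (hf : ∀ t, ∀ a ∈ FA t, f a ∈ FB t)
    (s n : ℕ)
    (x : A) (hx : x ∈ FA s)
    (y y' : B) (hy : y ∈ FB (s + n)) (hy' : y' ∈ FB (s + n))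
    (h1 : ∃ a : A, a - x ∈ FA (s + 1) ∧ f a - y ∈ FB (s + n + 1))
    (h2 : ∃ a : A, a - x ∈ FA (s + 1) ∧ f a - y' ∈ FB (s + n + 1)) :
    ∃ c : A, c ∈ FA (s + 1) ∧ f c - (y - y') ∈ FB (s + n + 1) := by
  obtain ⟨a, hax, hay⟩ := h1
  obtain ⟨a', hax', hay'⟩ := h2
  refine ⟨a - a', ?_, ?_⟩
  · simpa using sub_mem hax hax'
  · rw [map_sub, sub_sub_sub_comm]
    exact sub_mem hay hay'
end

section
/- Let A and B be abelian groups with filtrations F_A, F_B, and let f : A → B be a filtration-preserving homomorphism. Let s, n, m be natural numbers with m > n, let x ∈ F_A s, y ∈ F_B (s+n), and y'' ∈ F_B (s+m). If there is an f-extension of length n from x (at filtration s) to y and also an f-extension of length m from x (at filtration s) to y'', then the f-extension from x to y is inessential: there exists c ∈ F_A (s+1) with f c − y ∈ F_B (s+n+1), i.e. y is also the target of an f-extension from an element of strictly higher filtration. -/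
/-- Proposition 2.8(3)(b) of the paper: if there is an
f-extension of length `n` from `x` to `y` and also one of strictly greater
length `m > n` from `x` to `y''`, then the f-extension from `x` to `y` is
inessential: `y` is the target of an f-extension from an element of strictly
higher filtration. -/
theorem ess_two_targets_longer_length
    {A B : Type*} [AddCommGroup A] [AddCommGroup B]
    (FA : ℕ → AddSubgroup A) (FB : ℕ → AddSubgroup B)
    (hFA : ∀ t, FA (t + 1) ≤ FA t) (hFB : ∀ t, FB (t + 1) ≤ FB t)
    (f : A →+ B) (hf : ∀ t, ∀ a ∈ FA t, f a ∈ FB t)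
    (s n m : ℕ) (hmn : n < m)
    (x : A) (hx : x ∈ FA s)
    (y : B) (hy : y ∈ FB (s + n))
    (y'' : B) (hy'' : y'' ∈ FB (s + m))
    (h1 : ∃ a : A, a - x ∈ FA (s + 1) ∧ f a - y ∈ FB (s + n + 1))
    (h2 : ∃ a : A, a - x ∈ FA (s + 1) ∧ f a - y'' ∈ FB (s + m + 1)) :
    ∃ c : A, c ∈ FA (s + 1) ∧ f c - y ∈ FB (s + n + 1) := by
  obtain ⟨a, hax, hay⟩ := h1
  obtain ⟨b, hbx, hby⟩ := h2
  have hanti : Antitone FB := antitone_nat_of_succ_le hFB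
  refine ⟨a - b, by simpa using sub_mem hax hbx, ?_⟩
  have hsum := sub_mem (sub_mem hay (hanti (by omega) hby)) (hanti (by omega) hy'')
  have heq : f (a - b) - y = f a - y - (f b - y'') - y'' := by
    rw [map_sub]
    abel
  rwa [heq]
end
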